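/- Fix μ, ν : {1,…,N} → ℕ with μ_i ν_i = 0 for all i, set γ_i := μ_i + ν_i, and let t ≥ 0. For κ : {1,…,N} → ℕ with Σ_i κ_i = t define in S: x^μ := x_1^{μ_1} ⋯ x_N^{μ_N}, z^κ := z_1^{κ_1} ⋯ z_N^{κ_N}, y^ν := y_N^{ν_N} ⋯ y_1^{ν_1}, d_κ := q^{−t(t−1)/2 − Σ_{1≤i<j≤N} κ_i γ_j} · x^μ z^κ y^ν, and u_κ := x_1^{μ_1+κ_1} ⋯ x_N^{μ_N+κ_N} · y_N^{ν_N+κ_N} ⋯ y_1^{ν_1+κ_1}. Then for every λ : {1,…,N} → ℕ with Σ_i λ_i = t one has u_λ = Σ_θ ( ∏_{i=1}^{N−1} q^{θ_i(λ_{i+1}+γ_{i+1})} · [λ_{i+1} choose θ_i] ) · d_{κ(θ)}, where the sum is over all tuples θ = (θ_1,…,θ_{N−1}) of natural numbers with 0 ≤ θ_i ≤ λ_{i+1} for each i, and κ(θ)_k := λ_k + θ_k − θ_{k−1} (with θ_0 := 0 and θ_N := 0). -/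

import Mathlib

open scoped BigOperators

noncomputable section

/-- The base field `F = ℚ(q)`, the field of rational functions in one variable over `ℚ`. -/
abbrev Fq : Type := RatFunc ℚ

/-- The element `q ∈ ℚ(q)`. -/
noncomputable def q : Fq := RatFunc.X

/-- Generators of the free algebra: `Sum.inl i` is `x_i` and `Sum.inr i` is `y_i`
(indices `0,…,N−1` corresponding to the indices `1,…,N` of the paper). -/
abbrev Gen (N : ℕ) := Fin N ⊕ Fin N

/-- `x_i` in the free algebra. -/
noncomputable def FX (N : ℕ) (i : Fin N) : FreeAlgebra Fq (Gen N) :=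
  FreeAlgebra.ι Fq (Sum.inl i)

/-- `y_i` in the free algebra. -/
noncomputable def FY (N : ℕ) (i : Fin N) : FreeAlgebra Fq (Gen N) :=
  FreeAlgebra.ι Fq (Sum.inr i)

/-- Scalars in the free algebra. -/
noncomputable def FC (N : ℕ) (a : Fq) : FreeAlgebra Fq (Gen N) :=
  algebraMap Fq _ a

/-- The defining relations of the algebra `S`:
`x_i x_j = q x_j x_i` for `i > j`; `y_i y_j = q y_j y_i` for `i < j`;
`y_i x_j = x_j y_i` for `i ≠ j`; and
`y_i x_i = q x_i y_i + (q − q⁻¹) Σ_{r=1}^{i−1} (−q)^r x_{i−r} y_{i−r}`. -/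
inductive SRel (N : ℕ) : FreeAlgebra Fq (Gen N) → FreeAlgebra Fq (Gen N) → Prop
  | xx (i j : Fin N) (h : j < i) :
      SRel N (FX N i * FX N j) (FC N q * (FX N j * FX N i))
  | yy (i j : Fin N) (h : i < j) :
      SRel N (FY N i * FY N j) (FC N q * (FY N j * FY N i))
  | yx (i j : Fin N) (h : i ≠ j) :
      SRel N (FY N i * FX N j) (FX N j * FY N i)
  | yxi (i : Fin N) :
      SRel N (FY N i * FX N i)
        (FC N q * (FX N i * FY N i) +
          FC N (q - q⁻¹) *
            ∑ r ∈ Finset.Icc 1 (i : ℕ),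
              FC N ((-q) ^ r) *
                (FX N ⟨(i : ℕ) - r, Nat.lt_of_le_of_lt (Nat.sub_le _ _) i.isLt⟩ *
                 FY N ⟨(i : ℕ) - r, Nat.lt_of_le_of_lt (Nat.sub_le _ _) i.isLt⟩))

/-- The algebra `S`: quotient of the free algebra by the defining relations. -/
abbrev SAlg (N : ℕ) := RingQuot (SRel N)

/-- `x_i ∈ S`. -/
noncomputable def xel (N : ℕ) (i : Fin N) : SAlg N :=
  RingQuot.mkAlgHom Fq (SRel N) (FX N i)

/-- `y_i ∈ S`. -/
noncomputable def yel (N : ℕ) (i : Fin N) : SAlg N :=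
  RingQuot.mkAlgHom Fq (SRel N) (FY N i)

/-- Scalars in `S`. -/
noncomputable def Cq (N : ℕ) (a : Fq) : SAlg N :=
  algebraMap Fq _ a

/-- `z_k = Σ_{r=0}^{k−1} (−q)^r x_{k−r} y_{k−r} ∈ S` (paper indexing `k = 0,1,…,N`,
with `z_0 = 0`); in the `0`-indexed generators this is
`Σ_{j < k} (−q)^{k−1−j} x_j y_j`. -/
noncomputable def zel (N : ℕ) (k : ℕ) : SAlg N :=
  ∑ j : Fin N,
    if (j : ℕ) < k then Cq N ((-q) ^ (k - 1 - (j : ℕ))) * (xel N j * yel N j) else 0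

/-- The balanced quantum integer `[k] = (q^k − q^{−k})/(q − q^{−1})`. -/
noncomputable def qint (k : ℕ) : Fq := (q ^ (k : ℤ) - q ^ (-(k : ℤ))) / (q - q⁻¹)

/-- The balanced quantum factorial `[k]!`. -/
noncomputable def qfact : ℕ → Fq
  | 0 => 1
  | k + 1 => qint (k + 1) * qfact k

/-- The balanced quantum binomial coefficient `[r choose s]`. -/
noncomputable def qbinom (r s : ℕ) : Fq := qfact r / (qfact s * qfact (r - s))

end

/-- The ordered monomial `x_1^{μ_1} ⋯ x_N^{μ_N}` (indices increasing from left to right). -/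
noncomputable def xmon (N : ℕ) (μ : Fin N → ℕ) : SAlg N :=
  ((List.finRange N).map fun i => xel N i ^ μ i).prod

/-- The ordered monomial `y_N^{ν_N} ⋯ y_1^{ν_1}` (indices decreasing from left to right). -/
noncomputable def ymon (N : ℕ) (ν : Fin N → ℕ) : SAlg N :=
  ((List.finRange N).reverse.map fun i => yel N i ^ ν i).prod

/-- The ordered monomial `z_1^{κ_1} ⋯ z_N^{κ_N}` (paper indexing of the `z`'s). -/
noncomputable def zmon (N : ℕ) (κ : Fin N → ℕ) : SAlg N :=
  ((List.finRange N).map fun c : Fin N => zel N ((c : ℕ) + 1) ^ κ c).prod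

/-- `d_κ := q^{−t(t−1)/2 − Σ_{i<j} κ_i γ_j} · x^μ z^κ y^ν`. -/
noncomputable def dElt (N t : ℕ) (μ ν γ κ : Fin N → ℕ) : SAlg N :=
  Cq N (q ^ (-(((t * (t - 1) / 2 : ℕ)) : ℤ) -
        ((∑ i : Fin N, ∑ j : Fin N, if i < j then κ i * γ j else 0 : ℕ) : ℤ))) *
    (xmon N μ * (zmon N κ * ymon N ν))

/-! ### The scalar `q` and balanced quantum binomials -/

lemma q_ne_zero : q ≠ 0 := RatFunc.X_ne_zero

lemma q_pow_ne_one {n : ℕ} (hn : n ≠ 0) : q ^ n ≠ 1 := by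
  intro h
  rw [q, ← RatFunc.algebraMap_X, ← map_pow, ← map_one (algebraMap (Polynomial ℚ) (RatFunc ℚ))] at h
  have h' := congrArg Polynomial.natDegree (RatFunc.algebraMap_injective ℚ h)
  simp at h'
  exact hn h'

lemma q_zpow_sum {ι : Type*} (s : Finset ι) (f : ι → ℤ) :
    q ^ (∑ i ∈ s, f i) = ∏ i ∈ s, q ^ f i := by
  classical
  induction s using Finset.induction_on with
  | empty => simp
  | insert i s hi ih => rw [Finset.sum_insert hi, Finset.prod_insert hi, zpow_add₀ q_ne_zero, ih]

lemma q_zpow_sub_ne_zero {n : ℕ} (hn : n ≠ 0) : q ^ (n : ℤ) - q ^ (-(n : ℤ)) ≠ 0 := by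
  intro h
  apply q_pow_ne_one (n := n + n) (by omega)
  rw [sub_eq_zero, zpow_neg, zpow_natCast] at h
  rw [pow_add]
  nth_rewrite 1 [h]
  exact inv_mul_cancel₀ (pow_ne_zero _ q_ne_zero)

lemma q_sub_inv_ne_zero : q - q⁻¹ ≠ 0 := by
  simpa using q_zpow_sub_ne_zero one_ne_zero

lemma qint_ne_zero {n : ℕ} (hn : n ≠ 0) : qint n ≠ 0 :=
  div_ne_zero (q_zpow_sub_ne_zero hn) q_sub_inv_ne_zero

lemma qfact_ne_zero (n : ℕ) : qfact n ≠ 0 := by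
  induction n with
  | zero => exact one_ne_zero
  | succ n ih => exact mul_ne_zero (qint_ne_zero n.succ_ne_zero) ih

lemma qbinom_zero_right (n : ℕ) : qbinom n 0 = 1 := by
  simp [qbinom, qfact, qfact_ne_zero]

lemma qbinom_self (n : ℕ) : qbinom n n = 1 := by
  simp [qbinom, qfact, qfact_ne_zero]

lemma qint_add (a b : ℕ) :
    qint (a + b) = q ^ (-(a : ℤ)) * qint b + q ^ (b : ℤ) * qint a := by
  have hq := q_ne_zero
  simp only [qint]
  rw [mul_div_assoc', mul_div_assoc', ← add_div, mul_sub, mul_sub]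
  simp only [← zpow_add₀ hq]
  congr 1
  push_cast
  rw [show (b : ℤ) + -a = -a + b by ring, show (b : ℤ) + a = a + b by ring,
    show -((a : ℤ) + b) = -a + -b by ring]
  ring

/-- The quantum Pascal rule. -/
lemma qbinom_succ_succ {l θ : ℕ} (h : θ < l) :
    qbinom (l + 1) (θ + 1) =
      q ^ (-((θ : ℤ) + 1)) * qbinom l (θ + 1) + q ^ ((l : ℤ) - θ) * qbinom l θ := by
  obtain ⟨m, rfl⟩ := Nat.exists_eq_add_of_lt h
  have h1 : θ + m + 1 + 1 - (θ + 1) = m + 1 := by omega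
  have h2 : θ + m + 1 - (θ + 1) = m := by omega
  have h3 : θ + m + 1 - θ = m + 1 := by omega
  have h4 : qint (θ + m + 1 + 1) =
      q ^ (-((θ : ℤ) + 1)) * qint (m + 1) + q ^ (((θ + m + 1 : ℕ) : ℤ) - θ) * qint (θ + 1) := by
    rw [show θ + m + 1 + 1 = (θ + 1) + (m + 1) by omega, qint_add]
    push_cast
    congr 3
    ring
  have e1 : qfact (θ + m + 1 + 1) = qint (θ + m + 1 + 1) * qfact (θ + m + 1) := rfl
  have e2 : qfact (θ + 1) = qint (θ + 1) * qfact θ := rfl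
  have e3 : qfact (m + 1) = qint (m + 1) * qfact m := rfl
  have n1 := qfact_ne_zero θ
  have n2 := qfact_ne_zero m
  have n3 := qint_ne_zero θ.succ_ne_zero
  have n4 := qint_ne_zero m.succ_ne_zero
  simp only [Nat.succ_eq_add_one] at n3 n4
  simp only [qbinom, h1, h2, h3]
  rw [e1, h4, e2, e3]
  generalize q ^ (-((θ : ℤ) + 1)) = a
  generalize q ^ (((θ + m + 1 : ℕ) : ℤ) - θ) = b
  field_simp

/-- The triangular number `n (n - 1) / 2`, as an integer. -/
def tri (n : ℕ) : ℤ := ((n * (n - 1) / 2 : ℕ) : ℤ)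

lemma two_mul_tri (n : ℕ) : 2 * tri n = (n : ℤ) * n - n := by
  have h : 2 * (n * (n - 1) / 2) = n * (n - 1) :=
    Nat.mul_div_cancel' (Nat.even_mul_pred_self n).two_dvd
  rw [tri, ← Nat.cast_ofNat, ← Nat.cast_mul, h]
  rcases n with _ | n
  · simp
  · push_cast [Nat.add_sub_cancel]
    ring

lemma tri_succ (n : ℕ) : tri (n + 1) = tri n + n := by
  have h1 := two_mul_tri n
  have h2 := two_mul_tri (n + 1)
  push_cast at h2
  linarith

/-- The coefficient of `b ^ θ * a ^ (l - θ)` in the quantum binomial theorem. -/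
noncomputable def binomCoeff (l θ : ℕ) : Fq := q ^ (-tri l + l * θ) * qbinom l θ

lemma binomCoeff_zero (l : ℕ) : q ^ (-(l : ℤ)) * binomCoeff l 0 = binomCoeff (l + 1) 0 := by
  simp only [binomCoeff, qbinom_zero_right, mul_one, ← zpow_add₀ q_ne_zero]
  congr 1
  rw [tri_succ]
  push_cast
  ring

lemma binomCoeff_last (l : ℕ) :
    q ^ ((l : ℤ) + 1) * binomCoeff l l = binomCoeff (l + 1) (l + 1) := by
  simp only [binomCoeff, qbinom_self, mul_one, ← zpow_add₀ q_ne_zero]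
  congr 1
  rw [tri_succ]
  push_cast
  ring

lemma binomCoeff_succ {l θ : ℕ} (h : θ < l) :
    q ^ (-(l : ℤ)) * binomCoeff l (θ + 1) + q ^ ((l : ℤ) + 1) * binomCoeff l θ =
      binomCoeff (l + 1) (θ + 1) := by
  simp only [binomCoeff, qbinom_succ_succ h, mul_add, ← mul_assoc, ← zpow_add₀ q_ne_zero]
  rw [tri_succ]
  congr 3
  all_goals push_cast; ring

lemma quantum_binomial {B : Type*} [CommRing B] [Algebra Fq B] (a b : B) (l : ℕ) :
    ∏ s ∈ Finset.range l, (q ^ (-(s : ℤ)) • a + q ^ ((s : ℤ) + 1) • b) =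
      ∑ θ ∈ Finset.range (l + 1), binomCoeff l θ • (b ^ θ * a ^ (l - θ)) := by
  induction l with
  | zero => simp [binomCoeff, tri, qbinom_self]
  | succ l ih =>
    rw [Finset.prod_range_succ, ih, mul_add, Finset.sum_mul, Finset.sum_mul,
      Finset.sum_range_succ' _ l, Finset.sum_range_succ _ l,
      Finset.sum_range_succ' _ (l + 1), Finset.sum_range_succ _ l,
      ← binomCoeff_zero, ← binomCoeff_last]
    have key : ∀ θ ∈ Finset.range l,
        binomCoeff (l + 1) (θ + 1) • (b ^ (θ + 1) * a ^ (l + 1 - (θ + 1))) =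
          (binomCoeff l (θ + 1) • (b ^ (θ + 1) * a ^ (l - (θ + 1)))) * (q ^ (-(l : ℤ)) • a) +
          (binomCoeff l θ • (b ^ θ * a ^ (l - θ))) * (q ^ ((l : ℤ) + 1) • b) := by
      intro θ hθ
      rw [Finset.mem_range] at hθ
      obtain ⟨m, rfl⟩ := Nat.exists_eq_add_of_lt hθ
      rw [← binomCoeff_succ hθ, show θ + m + 1 + 1 - (θ + 1) = m + 1 by omega,
        show θ + m + 1 - (θ + 1) = m by omega, show θ + m + 1 - θ = m + 1 by omega]
      simp only [Algebra.smul_def, map_add, map_mul]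
      ring
    rw [Finset.sum_congr rfl key, Finset.sum_add_distrib]
    simp only [Algebra.smul_def, map_mul, Nat.sub_self, Nat.sub_zero]
    ring

/-! ### Commutation up to a power of `q` -/

section QComm

variable {A : Type*} [Ring A] [Algebra Fq A]

/-- `a` and `b` commute up to the scalar `q ^ n`. -/
def QComm (n : ℤ) (a b : A) : Prop := a * b = q ^ n • (b * a)

lemma QComm.eq {n : ℤ} {a b : A} (h : QComm n a b) : a * b = q ^ n • (b * a) := h

lemma QComm.symm {n : ℤ} {a b : A} (h : QComm n a b) : QComm (-n) b a := by
  rw [QComm, h.eq, smul_smul, ← zpow_add₀ q_ne_zero, neg_add_cancel, zpow_zero, one_smul]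

lemma QComm.one_right (a : A) : QComm 0 a 1 := by simp [QComm]

lemma QComm.zero_right (n : ℤ) (a : A) : QComm n a 0 := by simp [QComm]

lemma QComm.mul_right {m n : ℤ} {a b c : A} (hb : QComm m a b) (hc : QComm n a c) :
    QComm (m + n) a (b * c) := by
  rw [QComm, ← mul_assoc, hb.eq, smul_mul_assoc, mul_assoc, hc.eq, mul_smul_comm, smul_smul,
    ← zpow_add₀ q_ne_zero, mul_assoc]

lemma QComm.add_right {n : ℤ} {a b c : A} (hb : QComm n a b) (hc : QComm n a c) :
    QComm n a (b + c) := by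
  rw [QComm, mul_add, hb.eq, hc.eq, add_mul, smul_add]

lemma QComm.smul_right {n : ℤ} {a b : A} (h : QComm n a b) (r : Fq) : QComm n a (r • b) := by
  rw [QComm, mul_smul_comm, h.eq, smul_mul_assoc, smul_comm]

lemma QComm.pow_right {n : ℤ} {a b : A} (h : QComm n a b) (k : ℕ) :
    QComm (k * n) a (b ^ k) := by
  induction k with
  | zero => simpa using QComm.one_right a
  | succ k ih =>
    rw [pow_succ]
    convert ih.mul_right h using 1
    push_cast
    ring

lemma QComm.pow_left {n : ℤ} {a b : A} (h : QComm n a b) (k : ℕ) :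
    QComm (k * n) (a ^ k) b := by
  simpa using (h.symm.pow_right k).symm

lemma QComm.pow_pow {n : ℤ} {a b : A} (h : QComm n a b) (k l : ℕ) :
    QComm (k * (l * n)) (a ^ k) (b ^ l) :=
  (h.pow_right l).pow_left k

lemma QComm.list_prod_right {ι : Type*} {a : A} {f : ι → A} {e : ι → ℤ} {L : List ι}
    (h : ∀ j ∈ L, QComm (e j) a (f j)) : QComm (L.map e).sum a (L.map f).prod := by
  induction L with
  | nil => simpa using QComm.one_right a
  | cons i L ih =>
    simp only [List.map_cons, List.sum_cons, List.prod_cons]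
    exact (h i (by simp)).mul_right (ih fun j hj => h j (by simp [hj]))

lemma QComm.sandwich {m n : ℤ} {a b x p y : A} (ha : QComm m a x) (hb : QComm n b (p * y))
    (u v : A) :
    u * a * (x * (p * y)) * (b * v) = q ^ (m - n) • (u * x * (a * b * p * (y * v))) := by
  have h : u * a * (x * (p * y)) * (b * v) = u * (a * x) * ((p * y) * b) * v := by
    simp only [mul_assoc]
  rw [h, ha.eq, hb.symm.eq, sub_eq_add_neg, zpow_add₀ q_ne_zero, mul_smul,
    smul_comm]
  simp only [mul_smul_comm, smul_mul_assoc, mul_assoc]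

end QComm

lemma exists_commRing_of_comm {A ι : Type} [Ring A] [Algebra Fq A] (w : ι → A)
    (hw : ∀ i j, w i * w j = w j * w i) :
    ∃ (B : Type) (_ : CommRing B) (_ : Algebra Fq B) (φ : B →ₐ[Fq] A) (z : ι → B),
      ∀ i, φ (z i) = w i := by
  have := Algebra.isMulCommutative_adjoin Fq (s := Set.range w) (by
    rintro _ ⟨i, rfl⟩ _ ⟨j, rfl⟩
    exact hw i j)
  exact ⟨Algebra.adjoin Fq (Set.range w), IsMulCommutative.instCommRing,
    Subalgebra.algebra _, (Algebra.adjoin Fq (Set.range w)).val,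
    fun i => ⟨w i, Algebra.subset_adjoin ⟨i, rfl⟩⟩, fun _ => rfl⟩

/-! ### Relations in `S` -/

section Relations

variable {N : ℕ}

lemma xel_mul_xel {i j : Fin N} (h : j < i) : QComm 1 (xel N i) (xel N j) := by
  have := RingQuot.mkAlgHom_rel Fq (SRel.xx i j h)
  simpa [QComm, xel, FC, Algebra.smul_def] using this

lemma yel_mul_yel {i j : Fin N} (h : i < j) : QComm 1 (yel N i) (yel N j) := by
  have := RingQuot.mkAlgHom_rel Fq (SRel.yy i j h)
  simpa [QComm, yel, FC, Algebra.smul_def] using this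

lemma yel_mul_xel {i j : Fin N} (h : i ≠ j) : QComm 0 (yel N i) (xel N j) := by
  have := RingQuot.mkAlgHom_rel Fq (SRel.yx i j h)
  simpa [QComm, xel, yel] using this

lemma zel_zero : zel N 0 = 0 := by simp [zel]

lemma zel_succ (i : Fin N) :
    zel N ((i : ℕ) + 1) = xel N i * yel N i + (-q) • zel N i := by
  have h : xel N i * yel N i =
      ∑ j : Fin N, if j = i then xel N i * yel N i else 0 := by simp
  rw [h, zel, zel, Finset.smul_sum, ← Finset.sum_add_distrib]
  refine Finset.sum_congr rfl fun j _ => ?_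
  rcases lt_trichotomy j i with hj | rfl | hj
  · have h1 : (j : ℕ) < i := hj
    rw [if_pos (by omega), if_neg hj.ne, if_pos h1, zero_add, Cq, Cq, ← Algebra.smul_def,
      ← Algebra.smul_def, smul_smul, ← pow_succ']
    congr 2
    omega
  · simp [Cq]
  · have h1 : (i : ℕ) < j := hj
    rw [if_neg (by omega), if_neg hj.ne', if_neg (by omega), smul_zero, add_zero]

lemma sum_Icc_xel_mul_yel (i : Fin N) :
    ∑ r ∈ Finset.Icc 1 (i : ℕ), (-q) ^ r •
        (xel N ⟨(i : ℕ) - r, Nat.lt_of_le_of_lt (Nat.sub_le _ _) i.isLt⟩ *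
          yel N ⟨(i : ℕ) - r, Nat.lt_of_le_of_lt (Nat.sub_le _ _) i.isLt⟩) =
      (-q) • zel N i := by
  rw [zel, ← Finset.sum_filter, Finset.smul_sum]
  refine Finset.sum_bij' (fun r _ => ⟨(i : ℕ) - r, Nat.lt_of_le_of_lt (Nat.sub_le _ _) i.isLt⟩)
    (fun j _ => (i : ℕ) - j) ?_ ?_ ?_ ?_ ?_
  · intro r hr
    simp only [Finset.mem_Icc] at hr
    simp only [Finset.mem_filter, Finset.mem_univ, true_and]
    omega
  · intro j hj
    simp only [Finset.mem_filter, Finset.mem_univ, true_and] at hj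
    simp only [Finset.mem_Icc]
    omega
  · intro r hr
    simp only [Finset.mem_Icc] at hr
    simp only
    omega
  · intro j hj
    simp only [Finset.mem_filter, Finset.mem_univ, true_and] at hj
    apply Fin.ext
    simp only
    omega
  · intro r hr
    simp only [Finset.mem_Icc] at hr
    simp only
    rw [Cq, ← Algebra.smul_def, smul_smul, ← pow_succ']
    congr 2
    omega

lemma yel_mul_xel_self (i : Fin N) :
    yel N i * xel N i = q • zel N ((i : ℕ) + 1) + zel N i := by
  have h := RingQuot.mkAlgHom_rel Fq (SRel.yxi i)
  simp only [FC, map_add, map_mul, map_sum, AlgHom.commutes] at h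
  simp only [← Algebra.smul_def] at h
  have hs := sum_Icc_xel_mul_yel i
  simp only [xel, yel] at hs ⊢
  rw [h, hs, zel_succ, smul_add, smul_smul, smul_smul, add_assoc]
  simp only [xel, yel]
  congr 1
  nth_rewrite 3 [← one_smul Fq (zel N i)]
  rw [← add_smul]
  congr 1
  have := q_ne_zero
  field_simp
  ring

lemma neg_q_smul (a : SAlg N) : (-q) • a = -(q • a) :=
  neg_smul q a

lemma xel_mul_yel_self (i : Fin N) :
    xel N i * yel N i = zel N ((i : ℕ) + 1) + q • zel N i := by
  rw [zel_succ, neg_q_smul, neg_add_cancel_right]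

lemma zel_xel_of_le (j : Fin N) {k : ℕ} (hk : k ≤ j) : QComm 1 (xel N j) (zel N k) := by
  induction k with
  | zero => rw [zel_zero]; exact QComm.zero_right _ _
  | succ k ih =>
    obtain ⟨i, rfl⟩ : ∃ i : Fin N, (i : ℕ) = k := ⟨⟨k, by omega⟩, rfl⟩
    have hij : i < j := by omega
    rw [zel_succ]
    refine QComm.add_right ?_ ((ih (by omega)).smul_right _)
    simpa using (xel_mul_xel hij).mul_right (yel_mul_xel hij.ne).symm

lemma zel_yel_of_le (j : Fin N) {k : ℕ} (hk : k ≤ j) : QComm (-1) (yel N j) (zel N k) := by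
  induction k with
  | zero => rw [zel_zero]; exact QComm.zero_right _ _
  | succ k ih =>
    obtain ⟨i, rfl⟩ : ∃ i : Fin N, (i : ℕ) = k := ⟨⟨k, by omega⟩, rfl⟩
    have hij : i < j := by omega
    rw [zel_succ]
    refine QComm.add_right ?_ ((ih (by omega)).smul_right _)
    simpa using (yel_mul_xel hij.ne').mul_right (yel_mul_yel hij).symm

lemma q_smul_q_inv {A : Type*} [Ring A] [Algebra Fq A] (a : A) : q • q⁻¹ • a = a := by
  rw [smul_smul, mul_inv_cancel₀ q_ne_zero, one_smul]

lemma zel_xel_of_lt (j : Fin N) {k : ℕ} (hk : (j : ℕ) < k) (hkN : k ≤ N) :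
    QComm (-1) (xel N j) (zel N k) := by
  induction k with
  | zero => omega
  | succ k ih =>
    obtain ⟨i, rfl⟩ : ∃ i : Fin N, (i : ℕ) = k := ⟨⟨k, by omega⟩, rfl⟩
    rcases eq_or_ne j i with rfl | hne
    · have h1 := (zel_xel_of_le j le_rfl).symm.eq
      have h2 : QComm 1 (zel N ((j : ℕ) + 1)) (xel N j) := by
        rw [QComm, zpow_one]
        nth_rewrite 1 [zel_succ]
        rw [add_mul, mul_assoc, yel_mul_xel_self, smul_mul_assoc, h1, mul_add, mul_smul_comm,
          zpow_neg, zpow_one, neg_q_smul, q_smul_q_inv, add_neg_cancel_right]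
      exact h2.symm
    · have hij : j < i := by omega
      rw [zel_succ]
      refine QComm.add_right ?_ ((ih (by omega) (by omega)).smul_right _)
      simpa using (xel_mul_xel hij).symm.mul_right (yel_mul_xel hij.ne').symm

lemma zel_yel_of_lt (j : Fin N) {k : ℕ} (hk : (j : ℕ) < k) (hkN : k ≤ N) :
    QComm 1 (yel N j) (zel N k) := by
  induction k with
  | zero => omega
  | succ k ih =>
    obtain ⟨i, rfl⟩ : ∃ i : Fin N, (i : ℕ) = k := ⟨⟨k, by omega⟩, rfl⟩
    rcases eq_or_ne j i with rfl | hne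
    · have h1 := (zel_yel_of_le j le_rfl).eq
      rw [QComm, zpow_one]
      nth_rewrite 1 [zel_succ]
      rw [mul_add, ← mul_assoc, yel_mul_xel_self, mul_smul_comm, h1, add_mul, smul_mul_assoc,
        zpow_neg, zpow_one, neg_q_smul, q_smul_q_inv, add_neg_cancel_right]
    · have hij : j < i := by omega
      rw [zel_succ]
      refine QComm.add_right ?_ ((ih (by omega) (by omega)).smul_right _)
      simpa using (yel_mul_xel hij.ne).mul_right (yel_mul_yel hij)

lemma zel_comm {k l : ℕ} (hk : k ≤ N) (hl : l ≤ N) : QComm 0 (zel N k) (zel N l) := by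
  induction l with
  | zero => rw [zel_zero]; exact QComm.zero_right _ _
  | succ l ih =>
    obtain ⟨i, rfl⟩ : ∃ i : Fin N, (i : ℕ) = l := ⟨⟨l, by omega⟩, rfl⟩
    rw [zel_succ]
    refine QComm.add_right ?_ ((ih (by omega)).smul_right _)
    rcases le_or_gt k (i : ℕ) with h | h
    · simpa using (zel_xel_of_le i h).symm.mul_right (zel_yel_of_le i h).symm
    · simpa using (zel_xel_of_lt i h hk).symm.mul_right (zel_yel_of_lt i h hk).symm

/-- The `z_k` generate a commutative subalgebra of `S`. -/
lemma exists_commRing_zel (N : ℕ) :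
    ∃ (B : Type) (_ : CommRing B) (_ : Algebra Fq B) (φ : B →ₐ[Fq] SAlg N) (z : Fin (N + 1) → B),
      ∀ k, φ (z k) = zel N k :=
  exists_commRing_of_comm (fun k : Fin (N + 1) => zel N k) fun k l => by
    simpa [QComm] using (zel_comm (N := N) (Nat.lt_succ_iff.mp k.2) (Nat.lt_succ_iff.mp l.2)).eq

lemma xel_pow_mul_yel_pow {B : Type*} [CommRing B] [Algebra Fq B] (φ : B →ₐ[Fq] SAlg N)
    {z : Fin (N + 1) → B} (hz : ∀ k, φ (z k) = zel N k) (i : Fin N) (l : ℕ) :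
    xel N i ^ l * yel N i ^ l =
      φ (∏ s ∈ Finset.range l, (q ^ (-(s : ℤ)) • z i.succ + q ^ ((s : ℤ) + 1) • z i.castSucc)) := by
  induction l with
  | zero => simp
  | succ l ih =>
    have h1 := ((zel_xel_of_lt i (Nat.lt_succ_self _) i.2).pow_left l).eq
    have h2 := ((zel_xel_of_le i le_rfl).pow_left l).eq
    rw [Finset.prod_range_succ_comm, map_mul, ← ih, map_add, map_smul, map_smul, hz, hz]
    rw [pow_succ, pow_succ', mul_assoc, ← mul_assoc (xel N i) (yel N i), xel_mul_yel_self,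
      ← mul_assoc, mul_add, mul_smul_comm, Fin.val_succ, Fin.val_castSucc]
    rw [h1, h2, smul_smul, zpow_add₀ q_ne_zero, zpow_one, mul_comm q]
    simp [add_mul, mul_assoc]

end Relations

/-! ### Rearranging `u_λ` -/

section Rearrange

variable {N : ℕ} (μ ν lam : Fin N → ℕ)

/-- The exponent of `q` picked up when all the factors `x_i ^ λ_i` and `y_i ^ λ_i` are moved
next to each other. -/
def moveExp (L : List (Fin N)) : ℤ :=
  (L.map fun i => (L.map fun j =>
    if i < j then (lam i : ℤ) * (μ j + ν j + lam j) else 0).sum).sum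

lemma moveExp_cons {i : Fin N} {L : List (Fin N)} (h : ∀ j ∈ L, i < j) :
    moveExp μ ν lam (i :: L) =
      (L.map fun j => (lam i : ℤ) * (μ j + ν j + lam j)).sum + moveExp μ ν lam L := by
  simp only [moveExp, List.map_cons, List.sum_cons, lt_irrefl, if_false, zero_add]
  congr 2
  · exact List.map_congr_left fun j hj => if_pos (h j hj)
  · exact List.map_congr_left fun j hj => by rw [if_neg (h j hj).not_gt, zero_add]

lemma xel_pow_comm_xprod {i : Fin N} {L : List (Fin N)} (h : ∀ j ∈ L, i < j) :
    QComm (L.map fun j => -((lam i : ℤ) * μ j)).sum (xel N i ^ lam i)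
      (L.map fun j => xel N j ^ μ j).prod := by
  refine QComm.list_prod_right fun j hj => ?_
  convert (xel_mul_xel (h j hj)).symm.pow_pow (lam i) (μ j) using 1
  ring

lemma yel_pow_comm_yprod {i : Fin N} {L : List (Fin N)} (h : ∀ j ∈ L, i < j) :
    QComm (L.map fun j => (lam i : ℤ) * ν j).sum (yel N i ^ lam i)
      (L.reverse.map fun j => yel N j ^ ν j).prod := by
  rw [← List.sum_reverse, ← List.map_reverse]
  refine QComm.list_prod_right fun j hj => ?_
  convert (yel_mul_yel (h j (List.mem_reverse.mp hj))).pow_pow (lam i) (ν j) using 1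
  ring

lemma yel_pow_comm_xyprod {i : Fin N} {L : List (Fin N)} (h : ∀ j ∈ L, i < j) :
    QComm (L.map fun j => (lam i : ℤ) * lam j).sum (yel N i ^ lam i)
      (L.map fun j => xel N j ^ lam j * yel N j ^ lam j).prod := by
  refine QComm.list_prod_right fun j hj => ?_
  convert ((yel_mul_xel (h j hj).ne).pow_pow (lam i) (lam j)).mul_right
    ((yel_mul_yel (h j hj)).pow_pow (lam i) (lam j)) using 1
  ring

lemma list_rearrange {L : List (Fin N)} (hL : L.Pairwise (· < ·)) :
    (L.map fun i => xel N i ^ (μ i + lam i)).prod *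
        (L.reverse.map fun i => yel N i ^ (ν i + lam i)).prod =
      q ^ (-moveExp μ ν lam L) •
        ((L.map fun i => xel N i ^ μ i).prod *
          ((L.map fun i => xel N i ^ lam i * yel N i ^ lam i).prod *
            (L.reverse.map fun i => yel N i ^ ν i).prod)) := by
  induction L with
  | nil => simp [moveExp]
  | cons i L ih =>
    rw [List.pairwise_cons] at hL
    have key := QComm.sandwich (xel_pow_comm_xprod μ lam hL.1)
      ((yel_pow_comm_xyprod lam hL.1).mul_right (yel_pow_comm_yprod ν lam hL.1))
      (xel N i ^ μ i) (yel N i ^ ν i)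
    have hexp : (L.map fun j => -((lam i : ℤ) * μ j)).sum -
        ((L.map fun j => (lam i : ℤ) * lam j).sum + (L.map fun j => (lam i : ℤ) * ν j).sum) =
        -(L.map fun j => (lam i : ℤ) * (μ j + ν j + lam j)).sum := by
      clear ih hL key
      induction L with
      | nil => simp
      | cons j L ih =>
        simp only [List.map_cons, List.sum_cons]
        linear_combination ih
    rw [hexp] at key
    simp only [List.map_cons, List.prod_cons, List.reverse_cons, List.map_append,
      List.prod_append, List.map_nil, List.prod_nil, mul_one]
    have h1 : ∀ a b c d X Y : SAlg N, a * b * X * (Y * (c * d)) = a * b * (X * Y) * (c * d) := by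
      intros
      simp only [mul_assoc]
    rw [pow_add, add_comm (ν i), pow_add, h1, ih hL.2, mul_smul_comm, smul_mul_assoc, key,
      smul_smul, ← zpow_add₀ q_ne_zero, moveExp_cons μ ν lam hL.1, neg_add,
      add_comm (-moveExp _ _ _ _)]

lemma moveExp_finRange :
    moveExp μ ν lam (List.finRange N) =
      ∑ i : Fin N, ∑ j : Fin N, if i < j then (lam i : ℤ) * (μ j + ν j + lam j) else 0 := by
  simp only [moveExp, Fin.sum_univ_def]

lemma xmon_mul_ymon :
    xmon N (fun i => μ i + lam i) * ymon N (fun i => ν i + lam i) =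
      q ^ (-∑ i : Fin N, ∑ j : Fin N, if i < j then (lam i : ℤ) * (μ j + ν j + lam j) else 0) •
        (xmon N μ *
          (((List.finRange N).map fun i => xel N i ^ lam i * yel N i ^ lam i).prod *
            ymon N ν)) := by
  rw [← moveExp_finRange]
  exact list_rearrange μ ν lam (List.pairwise_lt_finRange N)

end Rearrange

/-! ### Expanding the product of the `x_i ^ λ_i * y_i ^ λ_i` -/

/-- The exponents `κ(θ)`. -/
def kap {N : ℕ} (lam θ : Fin N → ℕ) (c : Fin N) : ℕ :=
  lam c + (if h : (c : ℕ) + 1 < N then θ ⟨(c : ℕ) + 1, h⟩ else 0) - θ c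

lemma prod_shift {B : Type*} [CommRing B] {M : ℕ} (z : Fin (M + 2) → B) {lam θ : Fin (M + 1) → ℕ}
    (hθ : ∀ a, θ a ≤ lam a) (h0 : θ 0 = 0) :
    ∏ a, z a.castSucc ^ θ a * z a.succ ^ (lam a - θ a) = ∏ c, z c.succ ^ kap lam θ c := by
  have hk : ∀ c, kap lam θ c =
      (if h : (c : ℕ) + 1 < M + 1 then θ ⟨(c : ℕ) + 1, h⟩ else 0) + (lam c - θ c) := by
    intro c
    have := hθ c
    unfold kap
    omega
  simp only [hk, pow_add, Finset.prod_mul_distrib]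
  congr 1
  rw [Fin.prod_univ_succ, h0, pow_zero, one_mul, Fin.prod_univ_castSucc (n := M)]
  simp
  rfl

lemma prod_xel_pow_mul_yel_pow {M : ℕ} (lam : Fin (M + 1) → ℕ) :
    ((List.finRange (M + 1)).map fun i => xel (M + 1) i ^ lam i * yel (M + 1) i ^ lam i).prod =
      ∑ θ ∈ (Fintype.piFinset fun a => Finset.range (lam a + 1)).filter (fun θ => θ 0 = 0),
        (∏ a, binomCoeff (lam a) (θ a)) • zmon (M + 1) (kap lam θ) := by
  obtain ⟨B, _, _, φ, z, hz⟩ := exists_commRing_zel (M + 1)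
  have hφ0 : φ (z 0) = 0 := by rw [hz]; exact zel_zero
  have h1 : ∀ θ : Fin (M + 1) → ℕ,
      φ (∏ c, z c.succ ^ kap lam θ c) = zmon (M + 1) (kap lam θ) := by
    intro θ
    rw [← List.prod_ofFn, map_list_prod, zmon, List.map_ofFn, List.ofFn_eq_map]
    congr 2
    funext c
    simp [hz]
  have h2 : ((List.finRange (M + 1)).map fun i =>
      xel (M + 1) i ^ lam i * yel (M + 1) i ^ lam i).prod =
      φ (∏ i, ∏ s ∈ Finset.range (lam i),
        (q ^ (-(s : ℤ)) • z i.succ + q ^ ((s : ℤ) + 1) • z i.castSucc)) := by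
    rw [← List.prod_ofFn, map_list_prod, List.map_ofFn, List.ofFn_eq_map]
    congr 2
    funext i
    exact xel_pow_mul_yel_pow φ hz i (lam i)
  rw [h2]
  simp only [quantum_binomial]
  rw [Finset.prod_univ_sum, map_sum, Finset.sum_filter]
  refine Finset.sum_congr rfl fun θ hθ => ?_
  simp only [Fintype.mem_piFinset, Finset.mem_range, Nat.lt_succ_iff] at hθ
  rw [Finset.prod_smul, map_smul]
  split_ifs with h0
  · rw [prod_shift z hθ h0, h1]
  · rw [Fin.prod_univ_succ (fun i : Fin (M + 1) => z i.castSucc ^ θ i * z i.succ ^ (lam i - θ i)),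
      Fin.castSucc_zero, map_mul, map_mul, map_pow, hφ0, zero_pow h0,
      zero_mul, zero_mul, smul_zero]

/-! ### Comparing powers of `q` -/

section Exponents

variable {N : ℕ}

lemma two_mul_sum_lt_mul (f : Fin N → ℤ) :
    2 * (∑ i, ∑ j, if i < j then f i * f j else 0) + ∑ i, f i * f i = (∑ i, f i) * ∑ i, f i := by
  have hswap : (∑ i, ∑ j, if i < j then f i * f j else 0) =
      ∑ i, ∑ j, if j < i then f i * f j else 0 := by
    rw [Finset.sum_comm]
    simp only [mul_comm]
  have hdiag : ∑ i, f i * f i = ∑ i, ∑ j, if i = j then f i * f j else 0 := by simp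
  rw [two_mul, hdiag, Finset.sum_mul_sum]
  nth_rewrite 2 [hswap]
  simp only [← Finset.sum_add_distrib]
  refine Finset.sum_congr rfl fun i _ => Finset.sum_congr rfl fun j _ => ?_
  rcases lt_trichotomy i j with h | h | h
  · simp [h, h.ne, h.not_gt]
  · simp [h]
  · simp [h, h.ne', h.not_gt]

lemma tri_sum (lam : Fin N → ℕ) :
    tri (∑ i, lam i) = ∑ i, tri (lam i) + ∑ i, ∑ j, if i < j then (lam i : ℤ) * lam j else 0 := by
  have h1 := two_mul_sum_lt_mul fun i => (lam i : ℤ)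
  have h2 := two_mul_tri (∑ i, lam i)
  have h3 : 2 * ∑ i, tri (lam i) = ∑ i, (lam i : ℤ) * lam i - ∑ i, (lam i : ℤ) := by
    rw [Finset.mul_sum, ← Finset.sum_sub_distrib]
    exact Finset.sum_congr rfl fun i _ => two_mul_tri _
  push_cast at h2
  linarith

lemma sum_kap_lt {lam θ : Fin N → ℕ} (hθ : ∀ a, θ a ≤ lam a) (h0 : ∀ h : 0 < N, θ ⟨0, h⟩ = 0)
    (j : Fin N) :
    (∑ i, if i < j then (kap lam θ i : ℤ) else 0) =
      (∑ i, if i < j then (lam i : ℤ) else 0) + θ j := by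
  let g : ℕ → ℤ := fun n => if h : n < N then θ ⟨n, h⟩ else 0
  have hk : ∀ i, (kap lam θ i : ℤ) = lam i + (g (i + 1) - g i) := by
    intro i
    have := hθ i
    simp only [kap, g, i.2, dif_pos]
    split_ifs with h <;> push_cast [this.trans (Nat.le_add_right _ _)] <;> ring
  have hsplit : ∀ i, (if i < j then (kap lam θ i : ℤ) else 0) =
      (if i < j then (lam i : ℤ) else 0) + if (i : ℕ) < j then g (i + 1) - g i else 0 := by
    intro i
    simp only [hk, ← Fin.lt_def]
    split_ifs <;> simp
  have htel : (∑ i : Fin N, if (i : ℕ) < j then g (i + 1) - g i else 0) = g j - g 0 := by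
    rw [Fin.sum_univ_eq_sum_range (fun n => if n < (j : ℕ) then g (n + 1) - g n else 0) N,
      ← Finset.sum_filter, ← Finset.sum_range_sub]
    congr 1
    ext n
    simp only [Finset.mem_filter, Finset.mem_range]
    omega
  have hg0 : g 0 = 0 := by
    simp only [g]
    split_ifs with h
    · simp [h0 h]
    · rfl
  simp only [hsplit, Finset.sum_add_distrib, htel, hg0]
  simp [g]

lemma sum_kap_mul {lam θ : Fin N → ℕ} (hθ : ∀ a, θ a ≤ lam a) (h0 : ∀ h : 0 < N, θ ⟨0, h⟩ = 0)
    (γ : Fin N → ℤ) :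
    (∑ i, ∑ j, if i < j then (kap lam θ i : ℤ) * γ j else 0) =
      (∑ i, ∑ j, if i < j then (lam i : ℤ) * γ j else 0) + ∑ j, (θ j : ℤ) * γ j := by
  rw [Finset.sum_comm, Finset.sum_comm (f := fun i j => if i < j then (lam i : ℤ) * γ j else 0),
    ← Finset.sum_add_distrib]
  refine Finset.sum_congr rfl fun j _ => ?_
  have h := congrArg (· * γ j) (sum_kap_lt hθ h0 j)
  simpa only [add_mul, Finset.sum_mul, ite_mul, zero_mul] using h

lemma exponent_eq (μ ν : Fin N → ℕ) {lam θ : Fin N → ℕ} (hθ : ∀ a, θ a ≤ lam a)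
    (h0 : ∀ h : 0 < N, θ ⟨0, h⟩ = 0) :
    -(∑ i, ∑ j, if i < j then (lam i : ℤ) * (μ j + ν j + lam j) else 0) +
        ∑ a, (-tri (lam a) + lam a * θ a) =
      ∑ a, (θ a : ℤ) * (lam a + (μ a + ν a)) + (-tri (∑ i, lam i) -
        ∑ i, ∑ j, if i < j then (kap lam θ i : ℤ) * (μ j + ν j) else 0) := by
  have hsplit : (∑ i, ∑ j, if i < j then (lam i : ℤ) * (μ j + ν j + lam j) else 0) =
      (∑ i, ∑ j, if i < j then (lam i : ℤ) * (μ j + ν j) else 0) +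
        ∑ i, ∑ j, if i < j then (lam i : ℤ) * lam j else 0 := by
    simp only [← Finset.sum_add_distrib]
    refine Finset.sum_congr rfl fun i _ => Finset.sum_congr rfl fun j _ => ?_
    split_ifs <;> ring
  have hcomm : ∑ a, (lam a : ℤ) * θ a = ∑ a, (θ a : ℤ) * lam a := by simp only [mul_comm]
  rw [sum_kap_mul hθ h0 fun j => (μ j : ℤ) + ν j, hsplit, tri_sum]
  simp only [Finset.sum_add_distrib, Finset.sum_neg_distrib, mul_add] at hcomm ⊢
  linarith

lemma coeff_eq (μ ν : Fin N → ℕ) {lam θ : Fin N → ℕ} (hθ : ∀ a, θ a ≤ lam a)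
    (h0 : ∀ h : 0 < N, θ ⟨0, h⟩ = 0) :
    q ^ (-∑ i, ∑ j, if i < j then (lam i : ℤ) * (μ j + ν j + lam j) else 0) *
        ∏ a, binomCoeff (lam a) (θ a) =
      (∏ a : Fin N, if (a : ℕ) = 0 then 1 else
          q ^ (θ a * (lam a + (μ a + ν a))) * qbinom (lam a) (θ a)) *
        q ^ (-tri (∑ i, lam i) -
          ((∑ i, ∑ j, if i < j then kap lam θ i * (μ j + ν j) else 0 : ℕ) : ℤ)) := by
  have hprod : (∏ a : Fin N, if (a : ℕ) = 0 then 1 else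
      q ^ (θ a * (lam a + (μ a + ν a))) * qbinom (lam a) (θ a)) =
      q ^ (∑ a, (θ a : ℤ) * (lam a + (μ a + ν a))) * ∏ a, qbinom (lam a) (θ a) := by
    rw [q_zpow_sum, ← Finset.prod_mul_distrib]
    refine Finset.prod_congr rfl fun a _ => ?_
    split_ifs with ha
    · have : θ a = 0 := by
        have := h0 a.pos
        rwa [show (⟨0, a.pos⟩ : Fin N) = a from Fin.ext ha.symm] at this
      simp [this, qbinom_zero_right]
    · rw [← zpow_natCast]
      push_cast
      rfl
  have hbin : ∏ a, binomCoeff (lam a) (θ a) =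
      q ^ (∑ a, (-tri (lam a) + lam a * θ a)) * ∏ a, qbinom (lam a) (θ a) := by
    rw [q_zpow_sum, ← Finset.prod_mul_distrib]
    rfl
  rw [hprod, hbin, ← mul_assoc, ← zpow_add₀ q_ne_zero, exponent_eq μ ν hθ h0,
    zpow_add₀ q_ne_zero, mul_right_comm]
  push_cast
  rfl

end Exponents

theorem stmt15 (N : ℕ) (hN : 2 ≤ N) (μ ν : Fin N → ℕ) (hμν : ∀ i, μ i * ν i = 0)
    (t : ℕ) (lam : Fin N → ℕ) (hlam : ∑ i : Fin N, lam i = t) :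
    xmon N (fun i => μ i + lam i) * ymon N (fun i => ν i + lam i) =
      ∑ θ ∈ (Fintype.piFinset fun a : Fin N => Finset.range (lam a + 1)).filter
          (fun θ => θ ⟨0, by omega⟩ = 0),
        Cq N (∏ a : Fin N, if (a : ℕ) = 0 then 1 else
            q ^ (θ a * (lam a + (μ a + ν a))) * qbinom (lam a) (θ a)) *
          dElt N t μ ν (fun i => μ i + ν i)
            (fun c => lam c + (if h : (c : ℕ) + 1 < N then θ ⟨(c : ℕ) + 1, h⟩ else 0)
              - θ c) := by
  obtain ⟨M, rfl⟩ : ∃ M, N = M + 1 := ⟨N - 1, by omega⟩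
  subst hlam
  rw [xmon_mul_ymon, prod_xel_pow_mul_yel_pow, Finset.sum_mul, Finset.mul_sum, Finset.smul_sum]
  refine Finset.sum_congr rfl fun θ hθ => ?_
  simp only [Finset.mem_filter, Fintype.mem_piFinset, Finset.mem_range, Nat.lt_succ_iff] at hθ
  rw [smul_mul_assoc, mul_smul_comm, smul_smul, coeff_eq μ ν hθ.1 fun _ => hθ.2, dElt, Cq, Cq,
    ← Algebra.smul_def, ← Algebra.smul_def, mul_smul]
  rfl
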